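/- Let A be an algebra and let w be a ternary L-term such that for every abelian tolerance T on A and every (a,b) ∈ T, w^A(a,a,b) = b and w^A(b,a,a) = b. Then every abelian tolerance on A is transitive, hence a congruence on A. -/

import Mathlib

open FirstOrder.Language FirstOrder.Language.Structure

universe u v w

/-- A binary relation on `A` is compatible with all (interpreted) operations of the
`L`-structure `A`. -/
def Compatible (L : FirstOrder.Language.{u, v}) (A : Type w) [L.Structure A]
    (T : A → A → Prop) : Prop :=
  ∀ (n : ℕ) (f : L.Functions n) (a b : Fin n → A),
    (∀ i, T (a i) (b i)) → T (funMap f a) (funMap f b)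

/-- A tolerance on `A`: a reflexive, symmetric, compatible binary relation. -/
def IsTolerance (L : FirstOrder.Language.{u, v}) (A : Type w) [L.Structure A]
    (T : A → A → Prop) : Prop :=
  Reflexive T ∧ Symmetric T ∧ Compatible L A T

/-- A congruence on `A`: a transitive tolerance. -/
def IsCongruence (L : FirstOrder.Language.{u, v}) (A : Type w) [L.Structure A]
    (T : A → A → Prop) : Prop :=
  IsTolerance L A T ∧ Transitive T

/-- The centralizer condition `C(S, T; δ)`: for every term `t(x, y₁, …, yₙ)`
(variable `0` playing the role of `x`), every `(a, b) ∈ S` and all pairs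
`(uᵢ, vᵢ) ∈ T`, if `(t(a, ū), t(a, v̄)) ∈ δ` then `(t(b, ū), t(b, v̄)) ∈ δ`. -/
def Centralizes (L : FirstOrder.Language.{u, v}) (A : Type w) [L.Structure A]
    (S T δ : A → A → Prop) : Prop :=
  ∀ (n : ℕ) (t : L.Term (Fin (n + 1))) (a b : A), S a b →
    ∀ u v : Fin n → A, (∀ i, T (u i) (v i)) →
      (δ (t.realize (Fin.cons a u)) (t.realize (Fin.cons a v)) →
        δ (t.realize (Fin.cons b u)) (t.realize (Fin.cons b v)))

/-- A relation compatible with the basic operations is compatible with every term operation. -/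
theorem Compatible.realize {L : FirstOrder.Language.{u, v}} {A : Type w} [L.Structure A]
    {T : A → A → Prop} (hT : Compatible L A T) {α : Type*} (t : L.Term α) {x y : α → A}
    (h : ∀ i, T (x i) (y i)) : T (t.realize x) (t.realize y) := by
  induction t with
  | var i => exact h i
  | func f ts ih => exact hT _ f _ _ ih

/-- If `wt` is a weak difference term for tolerances on the algebra `A`, then every
abelian tolerance on `A` is transitive, hence a congruence. -/
theorem abelian_tolerance_isCongruence {L : FirstOrder.Language.{u, v}}
    {A : Type w} [L.Structure A] (wt : L.Term (Fin 3))
    (hw : ∀ T : A → A → Prop, IsTolerance L A T → Centralizes L A T T Eq →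
      ∀ a b : A, T a b → wt.realize ![a, a, b] = b ∧ wt.realize ![b, a, a] = b) :
    ∀ T : A → A → Prop, IsTolerance L A T → Centralizes L A T T Eq →
      Transitive T ∧ IsCongruence L A T := by
  intro T hT hab
  have htrans : Transitive T := by
    intro a b c h₁ h₂
    have h : T (wt.realize ![a, b, b]) (wt.realize ![b, b, c]) := by
      refine hT.2.2.realize wt fun i => ?_
      fin_cases i
      · exact h₁
      · exact hT.1 b
      · exact h₂
    rwa [(hw T hT hab b a (hT.2.1 h₁)).2, (hw T hT hab b c h₂).1] at h
  exact ⟨htrans, hT, htrans⟩
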